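/- arXiv:2411.08484 — 4 statements merged into one kernel-verified Lean document; each statement's English description precedes it below -/
import Mathlib

section
/- For every real number a > 0 that is not an odd integer multiple of π, the integral ∫₀¹ 1/((a² + (ln x)²)(1 + x)) dx equals π/(4a) − 2 · Σ_{k=0}^∞ (ln a − ln π − ln(2k+1)) / (a² − (2k+1)²π²). -/
open Real MeasureTheory

open Set Filter Topology

/-- The Mittag-Leffler expansion of `coth (t / 2)`. -/
theorem hasSum_coth_half {t : ℝ} (ht : 0 < t) :
    HasSum (fun n : ℕ ↦ 4 * t / (t ^ 2 + (2 * π * (n + 1)) ^ 2))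
      ((1 + exp (-t)) / (1 - exp (-t)) - 2 / t) := by
  set z : ℂ := Complex.I * t / (2 * π) with hz
  have hpi : (π : ℂ) ≠ 0 := by exact_mod_cast pi_ne_zero
  have htc : (t : ℂ) ≠ 0 := by exact_mod_cast ht.ne'
  have hzim : z.im = t / (2 * π) := by
    have : z = ((t / (2 * π) : ℝ) : ℂ) * Complex.I := by rw [hz]; push_cast; ring
    rw [this, Complex.im_ofReal_mul, Complex.I_im, mul_one]
  have hzmem : z ∈ Complex.integerComplement := by
    rintro ⟨n, hn⟩
    have h := congrArg Complex.im hn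
    rw [hzim] at h
    simp only [Complex.intCast_im] at h
    exact (by positivity : (0 : ℝ) < t / (2 * π)).ne h
  have hsum := (Summable.hasSum_iff_tendsto_nat (summable_cotTerm hzmem)).mpr
    (tendsto_logDeriv_euler_cot_sub hzmem)
  have hq : exp (-t) < 1 := exp_lt_one_iff.mpr (by linarith)
  have hexp : Complex.exp (2 * π * Complex.I * z) = (exp (-t) : ℝ) := by
    rw [Complex.ofReal_exp]
    congr 1
    rw [hz]
    push_cast
    field_simp
    linear_combination Complex.I_sq
  have hqc : (1 : ℂ) - (exp (-t) : ℝ) ≠ 0 := by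
    exact_mod_cast (sub_pos.mpr hq).ne'
  rw [Complex.cot_pi_eq_exp_ratio, hexp] at hsum
  rw [← Complex.hasSum_ofReal]
  have hsum' := hsum.mul_left (Complex.I / π)
  convert! hsum' using 1
  · funext n
    have hd : (t : ℂ) ^ 2 + (2 * π * (n + 1)) ^ 2 ≠ 0 := by
      exact_mod_cast (by positivity : (t ^ 2 + (2 * π * (n + 1)) ^ 2 : ℝ) ≠ 0)
    have h1 : z - (n + 1) ≠ 0 := by
      intro h
      have := congrArg Complex.im h
      simp [hzim] at this
      exact ht.ne' this
    have h2 : z + (n + 1) ≠ 0 := by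
      intro h
      have := congrArg Complex.im h
      simp [hzim] at this
      exact ht.ne' this
    have hzz : 2 * π * z = Complex.I * t := by rw [hz]; field_simp
    rw [cotTerm]
    push_cast
    rw [div_add_div _ _ h1 h2, div_mul_div_comm, div_eq_div_iff hd (by simp [hpi, h1, h2])]
    refine mul_left_cancel₀ hpi ?_
    linear_combination (t * (2 * π * z + Complex.I * t) -
      Complex.I * (t ^ 2 + (2 * π * (n + 1)) ^ 2)) * hzz -
      (2 * π * (n + 1)) ^ 2 * t * Complex.I_sq
  · rw [hz]
    push_cast at hqc ⊢
    have hI := Complex.I_ne_zero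
    field_simp
    ring

/-- The partial fraction expansion of `tanh (t / 2)`. -/
theorem hasSum_tanh_half {t : ℝ} (ht : 0 < t) :
    HasSum (fun k : ℕ ↦ 4 * t / (t ^ 2 + ((2 * k + 1) * π) ^ 2))
      ((1 - exp (-t)) / (1 + exp (-t))) := by
  have hA := (hasSum_coth_half (t := 2 * t) (by positivity)).mul_left 2
  have hB := hasSum_coth_half ht
  set g : ℕ → ℝ := fun n ↦ 4 * t / (t ^ 2 + (π * (n + 1)) ^ 2) with hg
  have hA' : HasSum g (2 * ((1 + exp (-(2 * t))) / (1 - exp (-(2 * t))) - 2 / (2 * t))) := by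
    convert! hA using 2 with n
    rw [hg]
    field_simp
  have hB' : HasSum (fun m : ℕ ↦ g (2 * m + 1)) ((1 + exp (-t)) / (1 - exp (-t)) - 2 / t) := by
    convert! hB using 2 with n
    rw [hg]
    push_cast
    ring_nf
  have hE : Summable fun m : ℕ ↦ g (2 * m) :=
    hA'.summable.comp_injective fun x y h ↦ by simpa using h
  have huniq := (hE.hasSum.even_add_odd hB').unique hA'
  have hq : exp (-t) < 1 := exp_lt_one_iff.mpr (by linarith)
  have hq0 := exp_pos (-t)
  have hsq : exp (-(2 * t)) = exp (-t) ^ 2 := by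
    rw [← exp_nat_mul]; congr 1; push_cast; ring
  have hval : ∑' m : ℕ, g (2 * m) = (1 - exp (-t)) / (1 + exp (-t)) := by
    rw [eq_sub_of_add_eq huniq, hsq]
    generalize exp (-t) = q at *
    have h1 : 1 - q ≠ 0 := by linarith
    have h2 : 1 + q ≠ 0 := by linarith
    have h3 : 1 - q ^ 2 = (1 - q) * (1 + q) := by ring
    rw [h3]
    field_simp
    ring
  rw [← hval]
  convert! hE.hasSum using 2 with k
  rw [hg]
  push_cast
  ring_nf

theorem hasDerivAt_log_sub_log {a b : ℝ} (ha : 0 < a) (hb : 0 < b) (hab : a ^ 2 - b ^ 2 ≠ 0)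
    (t : ℝ) :
    HasDerivAt
      (fun t ↦ (log (t ^ 2 + b ^ 2) - log (t ^ 2 + a ^ 2)) / (2 * (a ^ 2 - b ^ 2)))
      (t / ((t ^ 2 + a ^ 2) * (t ^ 2 + b ^ 2))) t := by
  have hA : t ^ 2 + a ^ 2 ≠ 0 := by positivity
  have hB : t ^ 2 + b ^ 2 ≠ 0 := by positivity
  have hp (c : ℝ) : HasDerivAt (fun t : ℝ ↦ t ^ 2 + c ^ 2) (2 * t) t := by
    simpa using (hasDerivAt_pow 2 t).add_const (c ^ 2)
  convert! (((hp b).log hB).sub ((hp a).log hA)).div_const (2 * (a ^ 2 - b ^ 2)) using 1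
  field_simp
  ring

theorem tendsto_log_sub_log (a b : ℝ) (ha : 0 < a) (hb : 0 < b) :
    Tendsto (fun t : ℝ ↦ (log (t ^ 2 + b ^ 2) - log (t ^ 2 + a ^ 2)) / (2 * (a ^ 2 - b ^ 2)))
      atTop (𝓝 0) := by
  have hden : Tendsto (fun t : ℝ ↦ t ^ 2 + a ^ 2) atTop atTop :=
    tendsto_atTop_add_const_right _ _ (tendsto_pow_atTop two_ne_zero)
  have h1 : Tendsto (fun t : ℝ ↦ 1 + (b ^ 2 - a ^ 2) / (t ^ 2 + a ^ 2)) atTop (𝓝 1) := by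
    simpa using (hden.const_div_atTop (b ^ 2 - a ^ 2)).const_add 1
  have h2 := (h1.log one_ne_zero).div_const (2 * (a ^ 2 - b ^ 2))
  rw [log_one, zero_div] at h2
  refine h2.congr fun t ↦ ?_
  have hA : t ^ 2 + a ^ 2 ≠ 0 := by positivity
  have hB : t ^ 2 + b ^ 2 ≠ 0 := by positivity
  rw [← log_div hB hA]
  congr 2
  field_simp
  ring

theorem integrableOn_div_mul_sq_add_sq {a b : ℝ} (ha : 0 < a) (hb : 0 < b)
    (hab : a ^ 2 - b ^ 2 ≠ 0) :
    IntegrableOn (fun t : ℝ ↦ t / ((t ^ 2 + a ^ 2) * (t ^ 2 + b ^ 2))) (Ioi 0) :=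
  integrableOn_Ioi_deriv_of_nonneg' (fun t _ ↦ hasDerivAt_log_sub_log ha hb hab t)
    (fun t ht ↦ by have := le_of_lt (mem_Ioi.mp ht); positivity) (tendsto_log_sub_log a b ha hb)

theorem integral_div_mul_sq_add_sq {a b : ℝ} (ha : 0 < a) (hb : 0 < b)
    (hab : a ^ 2 - b ^ 2 ≠ 0) :
    ∫ t in Ioi (0 : ℝ), t / ((t ^ 2 + a ^ 2) * (t ^ 2 + b ^ 2)) =
      (log a - log b) / (a ^ 2 - b ^ 2) := by
  rw [integral_Ioi_of_hasDerivAt_of_nonneg' (fun t _ ↦ hasDerivAt_log_sub_log ha hb hab t)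
    (fun t ht ↦ by have := le_of_lt (mem_Ioi.mp ht); positivity) (tendsto_log_sub_log a b ha hb)]
  simp only [ne_eq, OfNat.ofNat_ne_zero, not_false_eq_true, zero_pow, zero_add, log_pow]
  field_simp
  push_cast
  ring

theorem hasDerivAt_arctan_div {a : ℝ} (ha : 0 < a) (t : ℝ) :
    HasDerivAt (fun t ↦ arctan (t / a) / a) (1 / (t ^ 2 + a ^ 2)) t := by
  have hA : t ^ 2 + a ^ 2 ≠ 0 := by positivity
  convert! (((hasDerivAt_id t).div_const a).arctan).div_const a using 1
  simp only [id]
  have : 1 + (t / a) ^ 2 ≠ 0 := by positivity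
  field_simp
  ring

theorem tendsto_arctan_div {a : ℝ} (ha : 0 < a) :
    Tendsto (fun t ↦ arctan (t / a) / a) atTop (𝓝 (π / 2 / a)) :=
  ((tendsto_arctan_atTop.mono_right nhdsWithin_le_nhds).comp
    (tendsto_id.atTop_div_const ha)).div_const a

theorem integrableOn_one_div_sq_add_sq {a : ℝ} (ha : 0 < a) :
    IntegrableOn (fun t : ℝ ↦ 1 / (t ^ 2 + a ^ 2)) (Ioi 0) :=
  integrableOn_Ioi_deriv_of_nonneg' (fun t _ ↦ hasDerivAt_arctan_div ha t)
    (fun t _ ↦ by positivity) (tendsto_arctan_div ha)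

theorem integral_one_div_sq_add_sq {a : ℝ} (ha : 0 < a) :
    ∫ t in Ioi (0 : ℝ), 1 / (t ^ 2 + a ^ 2) = π / (2 * a) := by
  rw [integral_Ioi_of_hasDerivAt_of_nonneg' (fun t _ ↦ hasDerivAt_arctan_div ha t)
    (fun t _ ↦ by positivity) (tendsto_arctan_div ha)]
  simp [div_div]

theorem image_exp_neg_Ioi_zero : (fun t : ℝ ↦ exp (-t)) '' Ioi 0 = Ioo 0 1 := by
  ext x
  constructor
  · rintro ⟨t, ht, rfl⟩
    exact ⟨exp_pos _, exp_lt_one_iff.mpr (by simpa using ht)⟩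
  · rintro ⟨h0, h1⟩
    exact ⟨-log x, by simpa using log_neg h0 h1, by simp [exp_log h0]⟩

/-- The substitution `x = exp (-t)`. -/
theorem integral_zero_one_eq_integral_exp_neg (g : ℝ → ℝ) :
    ∫ x in (0 : ℝ)..1, g x = ∫ t in Ioi (0 : ℝ), exp (-t) * g (exp (-t)) := by
  rw [intervalIntegral.integral_of_le zero_le_one, integral_Ioc_eq_integral_Ioo,
    ← image_exp_neg_Ioi_zero,
    integral_image_eq_integral_abs_deriv_smul (f' := fun t ↦ -exp (-t)) measurableSet_Ioi
      (fun t _ ↦ by simpa using ((hasDerivAt_id t).neg.exp).hasDerivWithinAt)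
      (fun x _ y _ h ↦ by simpa using h)]
  simp

theorem bdh_integral_three (a : ℝ) (ha : 0 < a)
    (hodd : ∀ n : ℤ, a ≠ (2 * n + 1) * π) :
    (∫ x in (0:ℝ)..1, 1 / ((a ^ 2 + Real.log x ^ 2) * (1 + x))) =
      π / (4 * a) -
        2 * ∑' k : ℕ,
          (Real.log a - Real.log π - Real.log (2 * k + 1)) /
            (a ^ 2 - (2 * k + 1) ^ 2 * π ^ 2) := by
  set b : ℕ → ℝ := fun k ↦ (2 * k + 1) * π with hb
  have hbpos (k : ℕ) : 0 < b k := by simp only [hb]; positivity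
  have hab (k : ℕ) : a ^ 2 - b k ^ 2 ≠ 0 := by
    have h1 : a - b k ≠ 0 := sub_ne_zero.mpr (by simpa [hb] using hodd k)
    have h2 : a + b k ≠ 0 := (add_pos ha (hbpos k)).ne'
    rw [sq_sub_sq]
    exact mul_ne_zero h2 h1
  set f : ℕ → ℝ → ℝ := fun k t ↦ t / ((t ^ 2 + a ^ 2) * (t ^ 2 + b k ^ 2)) with hf
  set S : ℝ → ℝ := fun t ↦ (1 - exp (-t)) / (1 + exp (-t)) * (1 / (t ^ 2 + a ^ 2)) / 4 with hS
  have hfint (k : ℕ) : IntegrableOn (f k) (Ioi 0) :=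
    integrableOn_div_mul_sq_add_sq ha (hbpos k) (hab k)
  have hfpos (k : ℕ) (t : ℝ) (ht : t ∈ Ioi (0 : ℝ)) : 0 ≤ f k t := by
    have := le_of_lt (mem_Ioi.mp ht)
    simp only [hf]
    positivity
  have hfS (t : ℝ) (ht : t ∈ Ioi (0 : ℝ)) : HasSum (fun k ↦ f k t) (S t) := by
    convert! ((hasSum_tanh_half (mem_Ioi.mp ht)).mul_right (1 / (t ^ 2 + a ^ 2))).div_const 4
      using 2 with k
    have hA : t ^ 2 + a ^ 2 ≠ 0 := by positivity
    have hB : t ^ 2 + b k ^ 2 ≠ 0 := by have := hbpos k; positivity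
    simp only [hf, hb] at hB ⊢
    field_simp
  have hSint : IntegrableOn S (Ioi 0) := by
    refine (integrableOn_one_div_sq_add_sq ha).mono' ?_ ?_
    · exact (by fun_prop : Measurable S).aestronglyMeasurable
    · filter_upwards [ae_restrict_mem measurableSet_Ioi] with t ht
      have hq : exp (-t) < 1 := exp_lt_one_iff.mpr (by simpa using ht)
      have hq0 := exp_pos (-t)
      have hA : 0 < 1 / (t ^ 2 + a ^ 2) := by positivity
      have hr0 : 0 ≤ (1 - exp (-t)) / (1 + exp (-t)) := div_nonneg (by linarith) (by linarith)
      have hr1 : (1 - exp (-t)) / (1 + exp (-t)) ≤ 1 := (div_le_one (by linarith)).mpr (by linarith)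
      rw [norm_of_nonneg (by simp only [hS]; positivity)]
      simp only [hS]
      nlinarith
  have hnorm (k : ℕ) : ∫ t in Ioi (0 : ℝ), ‖f k t‖ = ∫ t in Ioi (0 : ℝ), f k t :=
    setIntegral_congr_fun measurableSet_Ioi fun t ht ↦ norm_of_nonneg (hfpos k t ht)
  have hsummable : Summable fun k ↦ ∫ t in Ioi (0 : ℝ), ‖f k t‖ := by
    refine summable_of_sum_le (c := ∫ t in Ioi (0 : ℝ), S t)
      (fun k ↦ integral_nonneg fun t ↦ norm_nonneg _) fun u ↦ ?_
    simp_rw [hnorm]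
    rw [← integral_finsetSum u fun k _ ↦ hfint k]
    exact setIntegral_mono_on (integrable_finsetSum u fun k _ ↦ hfint k) hSint measurableSet_Ioi
      fun t ht ↦ sum_le_hasSum u (fun k _ ↦ hfpos k t ht) (hfS t ht)
  have hswap : ∑' k, ∫ t in Ioi (0 : ℝ), f k t = ∫ t in Ioi (0 : ℝ), S t := by
    rw [integral_tsum_of_summable_integral_norm hfint hsummable]
    exact setIntegral_congr_fun measurableSet_Ioi fun t ht ↦ (hfS t ht).tsum_eq
  have hterm (k : ℕ) :
      (Real.log a - Real.log π - Real.log (2 * k + 1)) / (a ^ 2 - (2 * k + 1) ^ 2 * π ^ 2) =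
        ∫ t in Ioi (0 : ℝ), f k t := by
    rw [integral_div_mul_sq_add_sq ha (hbpos k) (hab k)]
    simp only [hb]
    rw [log_mul (by positivity) pi_ne_zero, mul_pow]
    ring_nf
  rw [tsum_congr hterm, hswap, integral_zero_one_eq_integral_exp_neg]
  have hmain : ∀ t ∈ Ioi (0 : ℝ),
      exp (-t) * (1 / ((a ^ 2 + log (exp (-t)) ^ 2) * (1 + exp (-t)))) =
        1 / 2 * (1 / (t ^ 2 + a ^ 2)) - 2 * S t := by
    intro t _
    have hA : t ^ 2 + a ^ 2 ≠ 0 := by positivity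
    have hA' : a ^ 2 + t ^ 2 ≠ 0 := by positivity
    have hq : 1 + exp (-t) ≠ 0 := by positivity
    simp only [hS, log_exp, neg_sq]
    field_simp
    ring
  rw [setIntegral_congr_fun measurableSet_Ioi hmain,
    integral_sub ((integrableOn_one_div_sq_add_sq ha).const_mul _) (hSint.const_mul _),
    integral_const_mul, integral_const_mul, integral_one_div_sq_add_sq ha]
  ring
end

section
/- For every real number a > 0, the integral ∫₀^∞ 1/((a² + (ln x)²)(1 + x)) dx equals π/(2a). -/
open Real MeasureTheory

theorem integrable_inv_sq_add_sq {a : ℝ} (ha : a ≠ 0) :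
    Integrable fun t : ℝ ↦ (a ^ 2 + t ^ 2)⁻¹ := by
  refine ((integrable_inv_one_add_sq.comp_div ha).const_mul (a ^ 2)⁻¹).congr (.of_forall fun t ↦ ?_)
  simp only [← mul_inv]
  congr 1
  field_simp

theorem integral_univ_inv_sq_add_sq {a : ℝ} (ha : 0 < a) :
    ∫ t : ℝ, (a ^ 2 + t ^ 2)⁻¹ = π / a := by
  have h (t : ℝ) : (a ^ 2 + t ^ 2)⁻¹ = (a ^ 2)⁻¹ * (1 + (t / a) ^ 2)⁻¹ := by
    rw [← mul_inv]
    congr 1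
    field_simp
  simp_rw [h]
  rw [integral_const_mul, Measure.integral_comp_div (fun t : ℝ ↦ (1 + t ^ 2)⁻¹) a,
    integral_univ_inv_one_add_sq, abs_of_pos ha, smul_eq_mul]
  field_simp

/-- The logistic function `t ↦ exp t / (1 + exp t)` averages to `1 / 2` against an even weight. -/
theorem integral_even_mul_logistic {f : ℝ → ℝ} (hf : Integrable f) (heven : ∀ t, f (-t) = f t) :
    ∫ t, f t * (exp t / (1 + exp t)) = (∫ t, f t) / 2 := by
  have hint : Integrable fun t ↦ f t * (exp t / (1 + exp t)) := by
    refine hf.mul_bdd (c := 1) (Measurable.aestronglyMeasurable (by fun_prop))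
      (.of_forall fun t ↦ ?_)
    have := exp_pos t
    rw [norm_of_nonneg (by positivity), div_le_one (by positivity)]
    linarith
  have hneg := integral_neg_eq_self (fun t ↦ f t * (exp t / (1 + exp t))) volume
  have hsum : ∫ t, f t = ∫ t, (f t * (exp t / (1 + exp t)) +
      f (-t) * (exp (-t) / (1 + exp (-t)))) := by
    congr 1 with t
    have := exp_pos t
    rw [heven, exp_neg]
    field_simp
    ring
  rw [integral_add hint hint.comp_neg, hneg] at hsum
  linarith

theorem bdh_integral_five (a : ℝ) (ha : 0 < a) :
    (∫ x in Set.Ioi (0:ℝ), 1 / ((a ^ 2 + Real.log x ^ 2) * (1 + x))) =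
      π / (2 * a) := by
  have hsubst := integral_image_eq_integral_abs_deriv_smul MeasurableSet.univ
    (fun t _ ↦ (hasDerivAt_exp t).hasDerivWithinAt) exp_injective.injOn
    (fun x ↦ 1 / ((a ^ 2 + log x ^ 2) * (1 + x)))
  rw [Set.image_univ, range_exp, setIntegral_univ] at hsubst
  have hlogistic := integral_even_mul_logistic (integrable_inv_sq_add_sq ha.ne')
    (fun t ↦ by rw [neg_sq])
  rw [integral_univ_inv_sq_add_sq ha] at hlogistic
  rw [hsubst, mul_comm 2 a, ← div_div, ← hlogistic]
  congr 1 with t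
  rw [abs_of_pos (exp_pos t), log_exp, smul_eq_mul]
  field_simp
end

section
/- The integral ∫₀¹ 1/((π² + (ln x)²)(1 + x)) dx equals 1/4 − 1/π² − (1/π²)·ln(π/2) + (1/2) · Σ_{k=1}^∞ (−1)^k · π^{2k−2} · B_{2k} / ((2k)! · k · (2k−1)). -/
open Real MeasureTheory

open Filter Topology Set

theorem tendsto_sum_two_mul_div_sq_add_sq (t : ℝ) (ht : 0 < t) :
    Tendsto (fun N : ℕ => ∑ n ∈ Finset.range N, 2 * t / (t ^ 2 + ((2 * n + 1) * π) ^ 2)) atTop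
      (𝓝 (1 / 2 - 1 / (1 + exp t))) := by
  have hπ : (π : ℂ) ≠ 0 := by exact_mod_cast pi_ne_zero
  set x : ℂ := 1 / 2 + Complex.I * (t / (2 * π)) with hx
  have hx' : x = ⟨1 / 2, t / (2 * π)⟩ := by
    rw [hx, Complex.mk_eq_add_mul_I]; push_cast; ring
  have him : x.im ≠ 0 := by
    rw [hx']
    positivity
  have hne : ∀ a : ℝ, x + a ≠ 0 := fun a h => him <| by
    simpa using congrArg Complex.im h
  have hxc : x ∈ Complex.integerComplement := by
    rintro ⟨n, hn⟩
    exact him (by rw [← hn]; simp)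
  have h1 := (summable_cotTerm hxc).hasSum.tendsto_sum_nat
  rw [← cot_series_rep' hxc] at h1
  have hexp : Complex.exp (2 * π * Complex.I * x) = -((exp (-t) : ℝ) : ℂ) := by
    rw [show 2 * π * Complex.I * x = π * Complex.I + ((-t : ℝ) : ℂ) by
      rw [hx]; push_cast; field_simp; linear_combination (t : ℂ) * Complex.I_sq,
      Complex.exp_add, Complex.exp_pi_mul_I, Complex.ofReal_exp]
    ring
  rw [Complex.cot_pi_eq_exp_ratio, hexp] at h1
  have h2 : Tendsto (fun N : ℕ => 1 / (x + (N : ℂ))) atTop (𝓝 0) := by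
    rw [tendsto_zero_iff_norm_tendsto_zero]
    refine squeeze_zero' (g := fun N : ℕ => 1 / (N : ℝ)) (Eventually.of_forall fun _ => norm_nonneg _) ?_
      tendsto_one_div_atTop_nhds_zero_nat
    filter_upwards [eventually_gt_atTop 0] with N hN
    rw [norm_div, norm_one]
    have hN' : (0 : ℝ) < N := by exact_mod_cast hN
    refine one_div_le_one_div_of_le hN' ?_
    refine le_trans ?_ (Complex.re_le_norm _)
    rw [Complex.add_re, hx', Complex.natCast_re]; linarith
  have key : ∀ N : ℕ, ((∑ n ∈ Finset.range N, 2 * t / (t ^ 2 + ((2 * n + 1) * π) ^ 2) : ℝ) : ℂ) =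
      Complex.I / (2 * π) *
        (1 / x + ∑ n ∈ Finset.range N, cotTerm x n - 1 / (x + (N : ℂ))) := by
    intro N
    induction N with
    | zero => simp
    | succ N ih =>
      rw [Finset.sum_range_succ, Finset.sum_range_succ, Complex.ofReal_add, ih]
      have e1 : x + N ≠ 0 := by simpa using hne N
      have e2 : x - (N + 1) ≠ 0 := by simpa [sub_eq_add_neg] using hne (-(N + 1))
      have e3 : x + (N + 1) ≠ 0 := by simpa using hne (N + 1)
      have hd : (t : ℂ) ^ 2 + ((2 * N + 1) * π) ^ 2 ≠ 0 := by
        have : (t ^ 2 + ((2 * N + 1) * π) ^ 2 : ℝ) ≠ 0 := by positivity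
        exact_mod_cast this
      have hprod : (x + N) * (x - (N + 1)) = -((t : ℂ) ^ 2 + ((2 * N + 1) * π) ^ 2) / (4 * π ^ 2) := by
        rw [hx]; field_simp
        linear_combination 4 * (t : ℂ) ^ 2 * Complex.I_sq
      have hterm : 1 / (x + N) + 1 / (x - (N + 1)) =
          -(4 * π * Complex.I * t) / ((t : ℂ) ^ 2 + ((2 * N + 1) * π) ^ 2) := by
        rw [div_add_div _ _ e1 e2, hprod,
          show 1 * (x - (N + 1)) + (x + N) * 1 = Complex.I * t / π by rw [hx]; field_simp; ring]
        field_simp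
      have : cotTerm x N = 1 / (x - (N + 1)) + 1 / (x + (N + 1)) := rfl
      rw [this]
      have h3 : ((2 * t / (t ^ 2 + ((2 * N + 1) * π) ^ 2) : ℝ) : ℂ) =
          Complex.I / (2 * π) * (1 / (x + N) + 1 / (x - (N + 1))) := by
        rw [hterm, div_mul_div_comm]
        push_cast
        rw [div_eq_div_iff hd (mul_ne_zero (by simp) hd)]
        linear_combination 4 * π * t * ((t : ℂ) ^ 2 + ((2 * N + 1) * π) ^ 2) * Complex.I_sq
      rw [h3]; push_cast; ring
  rw [← tendsto_ofReal_iff]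
  have h3 := (((tendsto_const_nhds (x := 1 / x)).add h1).sub h2).const_mul (Complex.I / (2 * π))
  refine (h3.congr fun N => (key N).symm).trans_eq ?_
  congr 1
  have e : (1 + exp (-t) : ℝ) ≠ 0 := by positivity
  have e' : (1 + (exp (-t) : ℝ) : ℂ) ≠ 0 := by exact_mod_cast e
  have : (1 / 2 - 1 / (1 + exp t)) = (1 - exp (-t)) / (2 * (1 + exp (-t))) := by
    rw [exp_neg]
    have := exp_pos t
    field_simp
    ring
  rw [this]
  push_cast at *
  rw [sub_neg_eq_add]
  have hI := Complex.I_ne_zero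
  field_simp
  ring

theorem integral_Ioi_two_mul_div (n : ℕ) :
    IntegrableOn (fun t : ℝ => 2 * t / (t ^ 2 + ((2 * n + 1) * π) ^ 2) / (π ^ 2 + t ^ 2)) (Ioi 0) ∧
    ∫ t in Ioi (0 : ℝ), 2 * t / (t ^ 2 + ((2 * n + 1) * π) ^ 2) / (π ^ 2 + t ^ 2) =
      if n = 0 then 1 / π ^ 2 else log (2 * n + 1) / (2 * n * (n + 1)) / π ^ 2 := by
  have hπ := pi_pos
  have hpos : ∀ t ∈ Ioi (0 : ℝ),
      0 ≤ 2 * t / (t ^ 2 + ((2 * n + 1) * π) ^ 2) / (π ^ 2 + t ^ 2) := by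
    intro t ht
    have : 0 < t := ht
    positivity
  rcases Nat.eq_zero_or_pos n with rfl | hn
  · have hd : ∀ t : ℝ, HasDerivAt (fun t : ℝ => -(π ^ 2 + t ^ 2)⁻¹)
        (2 * t / (t ^ 2 + ((2 * (0 : ℕ) + 1) * π) ^ 2) / (π ^ 2 + t ^ 2)) t := by
      intro t
      have h := (((hasDerivAt_pow 2 t).const_add (π ^ 2)).fun_inv (by positivity)).fun_neg
      convert! h using 1
      simp; field_simp; ring
    have hl : Tendsto (fun t : ℝ => -(π ^ 2 + t ^ 2)⁻¹) atTop (𝓝 0) := by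
      have : Tendsto (fun t : ℝ => π ^ 2 + t ^ 2) atTop atTop :=
        tendsto_atTop_add_const_left _ _ (tendsto_pow_atTop two_ne_zero)
      simpa using this.inv_tendsto_atTop.neg
    refine ⟨integrableOn_Ioi_deriv_of_nonneg' (fun t _ => hd t) hpos hl, ?_⟩
    rw [integral_Ioi_of_hasDerivAt_of_nonneg' (fun t _ => hd t) hpos hl]
    simp
  · set c : ℝ := 2 * n + 1 with hc
    have hn' : (0 : ℝ) < n := by exact_mod_cast hn
    have hc1 : c ^ 2 - 1 = 4 * n * (n + 1) := by rw [hc]; ring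
    have hc0 : 0 < c := by positivity
    have hd : ∀ t : ℝ, HasDerivAt
        (fun t : ℝ => (log (π ^ 2 + t ^ 2) - log (t ^ 2 + (c * π) ^ 2)) / ((c ^ 2 - 1) * π ^ 2))
        (2 * t / (t ^ 2 + (c * π) ^ 2) / (π ^ 2 + t ^ 2)) t := by
      intro t
      have h := ((((hasDerivAt_pow 2 t).const_add (π ^ 2)).log (by positivity)).fun_sub
        (((hasDerivAt_pow 2 t).add_const ((c * π) ^ 2)).log (by positivity))).div_const
          ((c ^ 2 - 1) * π ^ 2)
      convert! h using 1
      have : c ^ 2 - 1 ≠ 0 := by rw [hc1]; positivity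
      simp; field_simp; ring
    have hl : Tendsto (fun t : ℝ => (log (π ^ 2 + t ^ 2) - log (t ^ 2 + (c * π) ^ 2)) /
        ((c ^ 2 - 1) * π ^ 2)) atTop (𝓝 0) := by
      have h1 : Tendsto (fun t : ℝ => t ^ 2 + (c * π) ^ 2) atTop atTop :=
        tendsto_atTop_add_const_right _ _ (tendsto_pow_atTop two_ne_zero)
      have h2 : Tendsto (fun t : ℝ => 1 + (π ^ 2 - (c * π) ^ 2) * (t ^ 2 + (c * π) ^ 2)⁻¹) atTop
          (𝓝 1) := by
        simpa using (h1.inv_tendsto_atTop.const_mul (π ^ 2 - (c * π) ^ 2)).const_add 1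
      have h3 := (h2.log one_ne_zero).div_const ((c ^ 2 - 1) * π ^ 2)
      rw [log_one, zero_div] at h3
      refine h3.congr fun t => ?_
      rw [← log_div (by positivity) (by positivity)]
      congr 2
      field_simp
      ring
    refine ⟨integrableOn_Ioi_deriv_of_nonneg' (fun t _ => hd t) hpos hl, ?_⟩
    rw [integral_Ioi_of_hasDerivAt_of_nonneg' (fun t _ => hd t) hpos hl, if_neg hn.ne', hc1]
    rw [mul_pow, zero_pow two_ne_zero, add_zero, zero_add, log_mul (by positivity) (by positivity),
      log_pow c]
    push_cast
    field_simp
    ring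

theorem integral_zero_one_eq_integral_Ioi :
    (∫ x in (0:ℝ)..1, 1 / ((π ^ 2 + Real.log x ^ 2) * (1 + x))) =
      ∫ t in Ioi (0 : ℝ), 1 / (1 + exp t) / (π ^ 2 + t ^ 2) := by
  have him : (fun t : ℝ => exp (-t)) '' Ioi 0 = Ioo 0 1 := by
    ext x
    constructor
    · rintro ⟨t, ht, rfl⟩
      exact ⟨exp_pos _, by simpa using ht⟩
    · rintro ⟨h0, h1⟩
      exact ⟨-log x, by simpa using log_neg h0 h1, by simp [exp_log h0]⟩
  rw [intervalIntegral.integral_of_le zero_le_one, integral_Ioc_eq_integral_Ioo, ← him,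
    integral_image_eq_integral_abs_deriv_smul measurableSet_Ioi (f' := fun t => -exp (-t))
      (fun t _ => by simpa using ((hasDerivAt_neg t).exp).hasDerivWithinAt)
      (fun a _ b _ h => by simpa using h)]
  refine setIntegral_congr_fun measurableSet_Ioi fun t _ => ?_
  have := exp_pos t
  have hπ := pi_pos
  simp only [abs_neg, abs_exp, log_exp, neg_sq, smul_eq_mul]
  rw [exp_neg]
  field_simp
  ring

theorem integral_Ioi_inv_pi_sq_add_sq :
    IntegrableOn (fun t : ℝ => 1 / 2 / (π ^ 2 + t ^ 2)) (Ioi 0) ∧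
    ∫ t in Ioi (0 : ℝ), 1 / 2 / (π ^ 2 + t ^ 2) = 1 / 4 := by
  have hπ := pi_pos
  have hpos : ∀ t ∈ Ioi (0 : ℝ), 0 ≤ 1 / 2 / (π ^ 2 + t ^ 2) := fun t _ => by positivity
  have hd : ∀ t : ℝ, HasDerivAt (fun t => arctan (t / π) / (2 * π)) (1 / 2 / (π ^ 2 + t ^ 2)) t := by
    intro t
    convert! (((hasDerivAt_id t).div_const π).arctan).div_const (2 * π) using 1
    simp; field_simp
  have hl : Tendsto (fun t => arctan (t / π) / (2 * π)) atTop (𝓝 (π / 2 / (2 * π))) :=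
    ((tendsto_nhds_of_tendsto_nhdsWithin tendsto_arctan_atTop).comp
      (tendsto_id.atTop_div_const hπ)).div_const _
  refine ⟨integrableOn_Ioi_deriv_of_nonneg' (fun t _ => hd t) hpos hl, ?_⟩
  rw [integral_Ioi_of_hasDerivAt_of_nonneg' (fun t _ => hd t) hpos hl]
  simp; field_simp; norm_num

theorem hasSum_pow_div_succ_mul {y : ℝ} (hy : |y| < 1) :
    HasSum (fun k : ℕ => y ^ (2 * (k + 1)) / ((k + 1) * (2 * (k + 1) - 1)))
      (y * (log (1 + y) - log (1 - y)) + log (1 - y ^ 2)) := by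
  have h1 := (hasSum_log_sub_log_of_abs_lt_one hy).mul_left y
  have h2 := hasSum_pow_div_log_of_abs_lt_one (x := y ^ 2) (by
    rw [abs_pow]; exact pow_lt_one₀ (abs_nonneg _) hy two_ne_zero)
  convert! h1.sub h2 using 1
  · ext k
    have : (2 * ((k : ℝ) + 1) - 1) = 2 * k + 1 := by ring
    rw [this]
    field_simp
    ring
  · ring

theorem sum_range_log_eq (N : ℕ) :
    ∑ n ∈ Finset.range N, (1 / (2 * (n + 1) : ℝ) * (log (1 + 1 / (2 * (n + 1) : ℝ)) -
        log (1 - 1 / (2 * (n + 1) : ℝ))) + log (1 - (1 / (2 * (n + 1) : ℝ)) ^ 2)) =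
      ∑ n ∈ Finset.range N,
          log (2 * (n + 1 : ℕ) + 1) / (2 * (n + 1 : ℕ) * ((n + 1 : ℕ) + 1)) +
        log (2 * N + 1) / (2 * N + 2) -
        log (∏ i ∈ Finset.range N, (2 * i + 2 : ℝ) / (2 * i + 1) * ((2 * i + 2) / (2 * i + 3))) := by
  induction N with
  | zero => simp
  | succ N ih =>
    rw [Finset.sum_range_succ, Finset.sum_range_succ, Finset.prod_range_succ, ih,
      log_mul (Finset.prod_ne_zero_iff.2 fun i _ => by positivity) (by positivity)]
    have e1 : (1 + 1 / (2 * (N + 1) : ℝ)) = (2 * N + 3) / (2 * N + 2) := by field_simp; ring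
    have e2 : (1 - 1 / (2 * (N + 1) : ℝ)) = (2 * N + 1) / (2 * N + 2) := by field_simp; ring
    have e3 : (1 - (1 / (2 * (N + 1) : ℝ)) ^ 2) =
        ((2 * N + 3) / (2 * N + 2)) * ((2 * N + 1) / (2 * N + 2)) := by field_simp; ring
    rw [e1, e2, e3]
    push_cast
    rw [show (2 * ((N : ℝ) + 1) + 1) = 2 * N + 3 by ring]
    simp only [log_mul, log_div, (by positivity : (2 * N + 3 : ℝ) ≠ 0), ne_eq, not_false_eq_true,
      (by positivity : (2 * N + 2 : ℝ) ≠ 0), (by positivity : (2 * N + 1 : ℝ) ≠ 0), div_eq_zero_iff, or_self]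
    field_simp
    ring

theorem tendsto_log_div_atTop_zero :
    Tendsto (fun N : ℕ => log (2 * N + 1) / (2 * N + 2)) atTop (𝓝 0) := by
  have h : Tendsto (fun N : ℕ => (2 * N + 1 : ℝ)) atTop atTop :=
    tendsto_atTop_add_const_right _ _ (tendsto_natCast_atTop_atTop.const_mul_atTop two_pos)
  have h2 := isLittleO_log_id_atTop.tendsto_div_nhds_zero.comp h
  refine squeeze_zero (fun N => div_nonneg (log_nonneg ?_) (by positivity)) (fun N => ?_) h2
  · have : (0 : ℝ) ≤ N := by positivity
    linarith
  · have : (0 : ℝ) ≤ N := by positivity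
    simp only [Function.comp, id]
    gcongr
    · exact log_nonneg (by linarith)
    · norm_num

theorem hasSum_bernoulli_series {s : ℝ}
    (hs : HasSum (fun n : ℕ => (1 / (2 * (n + 1) : ℝ) * (log (1 + 1 / (2 * (n + 1) : ℝ)) -
        log (1 - 1 / (2 * (n + 1) : ℝ))) + log (1 - (1 / (2 * (n + 1) : ℝ)) ^ 2))) s) :
    HasSum (fun k : ℕ => (-1 : ℝ) ^ (k + 1) * π ^ (2 * (k + 1) - 2) *
              (bernoulli (2 * (k + 1)) : ℝ) /
                ((Nat.factorial (2 * (k + 1)) : ℝ) * (k + 1) * (2 * (k + 1) - 1)))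
      (-(2 / π ^ 2) * s) := by
  set F : ℕ × ℕ → ℝ := fun p =>
    (1 / (2 * (p.1 + 1) : ℝ)) ^ (2 * (p.2 + 1)) / ((p.2 + 1) * (2 * (p.2 + 1) - 1)) with hF
  have hrow : ∀ n : ℕ, HasSum (fun k => F (n, k)) _ := fun n =>
    hasSum_pow_div_succ_mul (y := 1 / (2 * (n + 1) : ℝ)) (by
      have : (0 : ℝ) ≤ n := by positivity
      rw [abs_of_nonneg (by positivity), div_lt_one (by positivity)]; linarith)
  have hF0 : 0 ≤ F := fun p => by
    have : (0 : ℝ) ≤ p.2 := by positivity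
    have : (0 : ℝ) < 2 * (p.2 + 1) - 1 := by linarith
    simp only [hF, Pi.zero_apply]
    positivity
  have hsum : Summable F := (summable_prod_of_nonneg hF0).2
    ⟨fun n => (hrow n).summable, by simpa only [(hrow _).tsum_eq] using hs.summable⟩
  have htot : HasSum F s := by
    have := hsum.hasSum.prod_fiberwise hrow
    rw [hs.unique this]
    exact hsum.hasSum
  have hcol : ∀ k : ℕ, HasSum (fun n => F (n, k)) (-(π ^ 2 / 2) *
      ((-1 : ℝ) ^ (k + 1) * π ^ (2 * (k + 1) - 2) * (bernoulli (2 * (k + 1)) : ℝ) /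
        ((Nat.factorial (2 * (k + 1)) : ℝ) * (k + 1) * (2 * (k + 1) - 1)))) := by
    intro k
    have hz := hasSum_zeta_nat (Nat.succ_ne_zero k)
    rw [← hasSum_nat_add_iff' 1] at hz
    have hk : (0 : ℝ) < 2 * (k + 1) - 1 := by
      have : (0 : ℝ) ≤ k := by positivity
      linarith
    convert! hz.mul_left ((1 / 2) ^ (2 * (k + 1)) / ((k + 1) * (2 * (k + 1) - 1)) : ℝ) using 1
    · ext n
      simp only [hF]
      push_cast
      rw [div_pow, div_pow, mul_pow, Nat.succ_eq_add_one]
      field_simp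
    · have e1 : 2 * (k + 1) - 2 = 2 * k := by lia
      have e2 : 2 * (k + 1) - 1 = 2 * k + 1 := by lia
      simp only [Nat.succ_eq_add_one, e1, e2]
      simp
      field_simp
      ring
  have h := ((Equiv.prodComm ℕ ℕ).hasSum_iff.2 htot).prod_fiberwise hcol
  convert! h.mul_left (-(2 / π ^ 2)) using 1
  ext k
  have := pi_ne_zero
  field_simp

theorem tendsto_sum_log_div :
    Tendsto (fun N : ℕ => ∑ n ∈ Finset.range N,
        log (2 * (n + 1 : ℕ) + 1) / (2 * (n + 1 : ℕ) * ((n + 1 : ℕ) + 1))) atTop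
      (𝓝 (π ^ 2 / 4 - 1 -
        π ^ 2 * ∫ t in Ioi (0 : ℝ), 1 / (1 + exp t) / (π ^ 2 + t ^ 2))) := by
  have hπ := pi_ne_zero
  obtain ⟨hA, hA'⟩ := integral_Ioi_inv_pi_sq_add_sq
  have hB : IntegrableOn (fun t : ℝ => 1 / (1 + exp t) / (π ^ 2 + t ^ 2)) (Ioi 0) := by
    refine hA.mono' ?_ ((ae_restrict_mem measurableSet_Ioi).mono fun t ht => ?_)
    · exact (by fun_prop : Measurable _).aestronglyMeasurable
    · have : 1 ≤ exp t := one_le_exp (le_of_lt ht)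
      rw [norm_of_nonneg (by positivity)]
      gcongr
      linarith
  have hint := integral_tendsto_of_tendsto_of_monotone (μ := volume.restrict (Ioi 0))
    (f := fun N t => ∑ n ∈ Finset.range N,
      2 * t / (t ^ 2 + ((2 * n + 1) * π) ^ 2) / (π ^ 2 + t ^ 2))
    (F := fun t => 1 / 2 / (π ^ 2 + t ^ 2) - 1 / (1 + exp t) / (π ^ 2 + t ^ 2))
    (fun N => integrable_finsetSum _ fun n _ => (integral_Ioi_two_mul_div n).1)
    (Integrable.sub hA hB)
    ((ae_restrict_mem measurableSet_Ioi).mono fun t ht => ?_)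
    ((ae_restrict_mem measurableSet_Ioi).mono fun t ht => ?_)
  · rw [integral_sub hA hB, hA'] at hint
    simp_rw [integral_finsetSum _ fun n _ => (integral_Ioi_two_mul_div n).1,
      (integral_Ioi_two_mul_div _).2] at hint
    rw [← tendsto_add_atTop_iff_nat 1] at hint
    simp_rw [Finset.sum_range_succ', if_pos, if_neg (Nat.succ_ne_zero _), ← Finset.sum_div] at hint
    refine ((hint.sub_const (1 / π ^ 2)).const_mul (π ^ 2)).congr' ?_ |>.trans_eq ?_
    · refine Eventually.of_forall fun N => ?_
      simp only [add_sub_cancel_right]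
      field_simp
    · congr 1
      field_simp
      ring
  · refine monotone_nat_of_le_succ fun N => ?_
    have : 0 < t := ht
    rw [Finset.sum_range_succ]
    exact le_add_of_nonneg_right (by positivity)
  · simp_rw [← Finset.sum_div, ← sub_div]
    exact (tendsto_sum_two_mul_div_sq_add_sq t ht).div_const _

theorem hasSum_log_terms :
    HasSum (fun n : ℕ => (1 / (2 * (n + 1) : ℝ) * (log (1 + 1 / (2 * (n + 1) : ℝ)) -
        log (1 - 1 / (2 * (n + 1) : ℝ))) + log (1 - (1 / (2 * (n + 1) : ℝ)) ^ 2)))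
      (π ^ 2 / 4 - 1 - π ^ 2 * (∫ t in Ioi (0 : ℝ), 1 / (1 + exp t) / (π ^ 2 + t ^ 2)) -
        log (π / 2)) := by
  rw [hasSum_iff_tendsto_nat_of_nonneg]
  · simp_rw [sum_range_log_eq]
    simpa using (tendsto_sum_log_div.add tendsto_log_div_atTop_zero).sub
      (tendsto_prod_pi_div_two.log (by positivity))
  · intro n
    have hn : (0 : ℝ) ≤ n := by positivity
    refine (hasSum_pow_div_succ_mul (y := 1 / (2 * (n + 1) : ℝ)) ?_).nonneg fun k => ?_
    · rw [abs_of_nonneg (by positivity), div_lt_one (by positivity)]; linarith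
    · have : (0 : ℝ) ≤ k := by positivity
      have : (0 : ℝ) < 2 * (k + 1) - 1 := by linarith
      positivity

theorem bdh_integral_seven :
    (∫ x in (0:ℝ)..1, 1 / ((π ^ 2 + Real.log x ^ 2) * (1 + x))) =
      1 / 4 - 1 / π ^ 2 - (1 / π ^ 2) * Real.log (π / 2) +
        (1 / 2) *
          ∑' k : ℕ,
            (-1 : ℝ) ^ (k + 1) * π ^ (2 * (k + 1) - 2) *
              (bernoulli (2 * (k + 1)) : ℝ) /
                ((Nat.factorial (2 * (k + 1)) : ℝ) * (k + 1) * (2 * (k + 1) - 1)) := by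
  have hπ := pi_ne_zero
  rw [(hasSum_bernoulli_series hasSum_log_terms).tsum_eq, integral_zero_one_eq_integral_Ioi]
  field_simp
  ring
end

section
/- The integral ∫₀¹ 1/((π² + (ln x)²)²·(1 + x)) dx equals 1/(8π²) − 3/(4π⁴) + (1/(8π⁴)) · Σ_{k=1}^∞ ln(2k+1) / (k²(k+1)²). -/
open Real MeasureTheory

open Set Filter Topology

/-- Mittag-Leffler expansion of the hyperbolic cotangent. -/
lemma hasSum_inv_sq_add_sq {s : ℝ} (hs : 0 < s) :
    HasSum (fun n : ℕ ↦ 1 / (s ^ 2 + ((n : ℝ) + 1) ^ 2))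
      ((π + 2 * π / (exp (2 * π * s) - 1) - 1 / s) / (2 * s)) := by
  have hsC : (s : ℂ) ≠ 0 := by exact_mod_cast hs.ne'
  have hz : Complex.I * s ∈ Complex.integerComplement :=
    UpperHalfPlane.coe_mem_integerComplement ⟨Complex.I * s, by simpa using hs⟩
  have hexp : 1 < exp (2 * π * s) := one_lt_exp_iff.2 (by positivity)
  have hsum := (summable_cotTerm hz).hasSum
  have hval : ∑' n, cotTerm (Complex.I * s) n =
      -Complex.I * ((π + 2 * π / (exp (2 * π * s) - 1) - 1 / s : ℝ) : ℂ) := by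
    have h := cot_series_rep' hz
    simp only [cotTerm]
    rw [← h, Complex.cot_eq_exp_ratio,
      show 2 * Complex.I * (π * (Complex.I * s)) = ((-(2 * π * s) : ℝ) : ℂ) by
        push_cast
        linear_combination (2 * π * s : ℂ) * Complex.I_sq,
      ← Complex.ofReal_exp, exp_neg]
    push_cast
    have h1 : (Complex.exp (2 * π * s)) ≠ 0 := Complex.exp_ne_zero _
    have h2 : Complex.exp (2 * π * s) - 1 ≠ 0 := by
      have : ((exp (2 * π * s) - 1 : ℝ) : ℂ) ≠ 0 := by
        exact_mod_cast (sub_pos.2 hexp).ne'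
      simpa using this
    generalize Complex.exp (2 * π * s) = e at *
    have h3 : 1 - e⁻¹ = (e - 1) / e := by field_simp
    rw [h3]
    field_simp
    linear_combination (s * π * (1 + e) - (e - 1) : ℂ) * Complex.I_sq
  rw [hval] at hsum
  have hsum' := hsum.mul_left (Complex.I / (2 * s))
  rw [← Complex.hasSum_ofReal]
  convert! hsum' using 1
  · ext n
    have h0 : ((s : ℂ) ^ 2 + ((n : ℂ) + 1) ^ 2) ≠ 0 := by
      have : s ^ 2 + ((n : ℝ) + 1) ^ 2 ≠ 0 := by positivity
      exact_mod_cast this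
    have h1 : ((Complex.I * s + (n + 1)) * (Complex.I * s - (n + 1)) : ℂ)
        = - ((s : ℂ) ^ 2 + ((n : ℂ) + 1) ^ 2) := by
      linear_combination (s ^ 2 : ℂ) * Complex.I_sq
    rw [cotTerm_identity hz, h1]
    push_cast
    field_simp
    linear_combination Complex.I_sq
  · push_cast
    field_simp
    simp

/-- Mittag-Leffler expansion of the hyperbolic tangent, written with the Fermi function. -/
lemma hasSum_div_sq_add_odd_sq {s : ℝ} (hs : 0 < s) :
    HasSum (fun n : ℕ ↦ s / (s ^ 2 + (2 * (n : ℝ) + 1) ^ 2))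
      (π / 4 - π / 2 * (1 / (exp (π * s) + 1))) := by
  have hall := hasSum_inv_sq_add_sq hs
  have heven := (hasSum_inv_sq_add_sq (half_pos hs)).mul_left (1 / 4)
  have hodd := (hall.summable.comp_injective
    (mul_right_injective₀ (two_ne_zero (α := ℕ)))).hasSum
  have h := hall.unique (hodd.even_add_odd (by
    convert! heven using 2 with n
    push_cast
    field_simp
    ring))
  convert! hodd.mul_left s using 1
  · ext n
    simp [div_eq_mul_inv]
  · have hexp : 1 < exp (π * s) := one_lt_exp_iff.2 (by positivity)
    have h1 : exp (2 * π * s) = exp (π * s) ^ 2 := by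
      rw [← exp_nat_mul]; congr 1; push_cast; ring
    rw [h1, show 2 * π * (s / 2) = π * s by ring] at h
    rw [← sub_eq_iff_eq_add] at h
    rw [← h]
    have h2 : exp (π * s) - 1 ≠ 0 := (sub_pos.2 hexp).ne'
    have h3 : exp (π * s) ^ 2 - 1 ≠ 0 := by nlinarith
    have h4 : exp (π * s) + 1 ≠ 0 := by positivity
    field_simp
    ring

lemma tendsto_inv_one_add_sq_atTop :
    Tendsto (fun s : ℝ ↦ (1 + s ^ 2)⁻¹) atTop (𝓝 0) :=
  (tendsto_atTop_add_const_left _ _ (tendsto_pow_atTop two_ne_zero)).inv_tendsto_atTop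

lemma hasDerivAt_inv_one_add_sq (s : ℝ) :
    HasDerivAt (fun s : ℝ ↦ (1 + s ^ 2)⁻¹) (-(2 * s) / (1 + s ^ 2) ^ 2) s := by
  simpa using! (((hasDerivAt_id s).pow 2).const_add 1).inv (show 1 + s ^ 2 ≠ 0 by positivity)

lemma integral_one_div_one_add_sq_sq :
    IntegrableOn (fun s : ℝ ↦ 1 / (1 + s ^ 2) ^ 2) (Ioi 0) ∧
      ∫ s in Ioi (0 : ℝ), 1 / (1 + s ^ 2) ^ 2 = π / 4 := by
  have hd : ∀ s ∈ Ici (0 : ℝ), HasDerivAt (fun s ↦ (arctan s + s * (1 + s ^ 2)⁻¹) / 2)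
      (1 / (1 + s ^ 2) ^ 2) s := fun s _ ↦ by
    convert! ((hasDerivAt_arctan s).add
      ((hasDerivAt_id s).mul (hasDerivAt_inv_one_add_sq s))).div_const 2 using 1
    simp only [id]
    field_simp
    ring
  have hpos : ∀ s ∈ Ioi (0 : ℝ), 0 ≤ 1 / (1 + s ^ 2) ^ 2 := fun s _ ↦ by positivity
  have hlim : Tendsto (fun s ↦ (arctan s + s * (1 + s ^ 2)⁻¹) / 2) atTop (𝓝 (π / 4)) := by
    have h1 : Tendsto (fun s : ℝ ↦ s * (1 + s ^ 2)⁻¹) atTop (𝓝 0) := by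
      refine squeeze_zero' (g := fun s : ℝ ↦ s⁻¹) ?_ ?_ tendsto_inv_atTop_zero
      · filter_upwards [eventually_gt_atTop 0] with s hs using by positivity
      · filter_upwards [eventually_gt_atTop 0] with s hs
        rw [← div_eq_mul_inv, div_le_iff₀ (by positivity)]
        field_simp
        linarith
    convert ((tendsto_nhds_of_tendsto_nhdsWithin tendsto_arctan_atTop).add h1).div_const 2 using 2
    ring
  refine ⟨integrableOn_Ioi_deriv_of_nonneg' hd hpos hlim, ?_⟩
  rw [integral_Ioi_of_hasDerivAt_of_nonneg' hd hpos hlim]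
  simp

lemma integral_div_one_add_sq_cube :
    IntegrableOn (fun s : ℝ ↦ s / ((1 + s ^ 2) ^ 2 * (s ^ 2 + 1))) (Ioi 0) ∧
      ∫ s in Ioi (0 : ℝ), s / ((1 + s ^ 2) ^ 2 * (s ^ 2 + 1)) = 1 / 4 := by
  have hd : ∀ s ∈ Ici (0 : ℝ), HasDerivAt (fun s ↦ -(((1 + s ^ 2)⁻¹) ^ 2) / 4)
      (s / ((1 + s ^ 2) ^ 2 * (s ^ 2 + 1))) s := fun s _ ↦ by
    convert! (((hasDerivAt_inv_one_add_sq s).pow 2).neg).div_const 4 using 1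
    simp only [Nat.cast_ofNat, Nat.add_one_sub_one, pow_one]
    rw [add_comm (s ^ 2) 1]
    field_simp
    ring
  have hpos : ∀ s ∈ Ioi (0 : ℝ), 0 ≤ s / ((1 + s ^ 2) ^ 2 * (s ^ 2 + 1)) := fun s hs ↦ by
    have : 0 < s := hs
    positivity
  have hlim : Tendsto (fun s : ℝ ↦ -(((1 + s ^ 2)⁻¹) ^ 2) / 4) atTop (𝓝 0) := by
    simpa using (tendsto_inv_one_add_sq_atTop.pow 2).neg.div_const 4
  refine ⟨integrableOn_Ioi_deriv_of_nonneg' hd hpos hlim, ?_⟩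
  rw [integral_Ioi_of_hasDerivAt_of_nonneg' hd hpos hlim]
  norm_num

lemma integral_div_one_add_sq_sq_mul {c : ℝ} (hc : 1 < c) :
    IntegrableOn (fun s : ℝ ↦ s / ((1 + s ^ 2) ^ 2 * (s ^ 2 + c))) (Ioi 0) ∧
      ∫ s in Ioi (0 : ℝ), s / ((1 + s ^ 2) ^ 2 * (s ^ 2 + c)) =
        (1 / (c - 1) - log c / (c - 1) ^ 2) / 2 := by
  have hc1 : 0 < c - 1 := sub_pos.2 hc
  have hd : ∀ s ∈ Ici (0 : ℝ), HasDerivAt (fun s ↦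
      (log (1 + (c - 1) * (1 + s ^ 2)⁻¹) / (c - 1) ^ 2 - (1 + s ^ 2)⁻¹ / (c - 1)) / 2)
      (s / ((1 + s ^ 2) ^ 2 * (s ^ 2 + c))) s := fun s _ ↦ by
    have h := hasDerivAt_inv_one_add_sq s
    convert! (((((h.const_mul (c - 1)).const_add 1).log (by positivity)).div_const _).sub
      (h.div_const (c - 1))).div_const 2 using 1
    have h1 : 1 + (c - 1) * (1 + s ^ 2)⁻¹ = (s ^ 2 + c) / (1 + s ^ 2) := by
      field_simp
      ring
    have h2 : s ^ 2 + c ≠ 0 := by positivity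
    rw [h1]
    field_simp
    ring
  have hpos : ∀ s ∈ Ioi (0 : ℝ), 0 ≤ s / ((1 + s ^ 2) ^ 2 * (s ^ 2 + c)) := fun s hs ↦ by
    have : 0 < s := hs
    positivity
  have hlim : Tendsto (fun s : ℝ ↦
      (log (1 + (c - 1) * (1 + s ^ 2)⁻¹) / (c - 1) ^ 2 - (1 + s ^ 2)⁻¹ / (c - 1)) / 2)
      atTop (𝓝 0) := by
    have h := tendsto_inv_one_add_sq_atTop
    simpa using ((((h.const_mul (c - 1)).const_add 1).log (by simp)).div_const
      ((c - 1) ^ 2)).sub (h.div_const (c - 1)) |>.div_const 2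
  refine ⟨integrableOn_Ioi_deriv_of_nonneg' hd hpos hlim, ?_⟩
  rw [integral_Ioi_of_hasDerivAt_of_nonneg' hd hpos hlim]
  simp
  ring

lemma hasSum_one_div_succ_mul_succ_succ :
    HasSum (fun k : ℕ ↦ 1 / (((k : ℝ) + 1) * ((k : ℝ) + 1 + 1))) 1 := by
  rw [hasSum_iff_tendsto_nat_of_nonneg (fun k ↦ by positivity)]
  have h : ∀ n : ℕ, ∑ k ∈ Finset.range n, 1 / (((k : ℝ) + 1) * ((k : ℝ) + 1 + 1)) =
      1 - 1 / ((n : ℝ) + 1) := fun n ↦ by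
    induction n with
    | zero => simp
    | succ n ih =>
      rw [Finset.sum_range_succ, ih]
      push_cast
      field_simp
      ring
  simp_rw [h]
  simpa using (tendsto_one_div_add_atTop_nhds_zero_nat (𝕜 := ℝ)).const_sub 1

lemma summable_log_odd_div :
    Summable fun k : ℕ ↦ log (2 * ((k : ℝ) + 1) + 1) /
      (((k : ℝ) + 1) ^ 2 * (((k : ℝ) + 1) + 1) ^ 2) := by
  refine .of_nonneg_of_le (fun k ↦ ?_) (fun k ↦ ?_)
    (hasSum_one_div_succ_mul_succ_succ.summable.mul_left 2)
  · have : 0 ≤ log (2 * ((k : ℝ) + 1) + 1) := log_nonneg (by linarith [k.cast_nonneg (α := ℝ)])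
    positivity
  · have h := log_le_sub_one_of_pos (show 0 < 2 * ((k : ℝ) + 1) + 1 by positivity)
    rw [div_le_iff₀ (by positivity)]
    refine h.trans ?_
    field_simp
    nlinarith [k.cast_nonneg (α := ℝ)]

lemma integral_eq_integral_Ioi_fermi :
    (∫ x in (0 : ℝ)..1, 1 / ((π ^ 2 + log x ^ 2) ^ 2 * (1 + x))) =
      1 / π ^ 3 * ∫ s in Ioi (0 : ℝ), 1 / (1 + s ^ 2) ^ 2 * (1 / (exp (π * s) + 1)) := by
  have himage : (fun s : ℝ ↦ exp (-(π * s))) '' Ioi 0 = Ioo 0 1 := by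
    ext x
    constructor
    · rintro ⟨s, hs, rfl⟩
      exact ⟨exp_pos _, by simpa using mul_pos pi_pos hs⟩
    · rintro ⟨h0, h1⟩
      refine ⟨-log x / π, div_pos (neg_pos.2 (log_neg h0 h1)) pi_pos, ?_⟩
      simp only
      rw [mul_div_cancel₀ _ pi_ne_zero, neg_neg, exp_log h0]
  have hderiv : ∀ s ∈ Ioi (0 : ℝ), HasDerivWithinAt (fun s : ℝ ↦ exp (-(π * s)))
      (exp (-(π * s)) * -π) (Ioi 0) s := fun s _ ↦ by
    simpa using ((((hasDerivAt_id s).const_mul π).neg).exp).hasDerivWithinAt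
  have hinj : InjOn (fun s : ℝ ↦ exp (-(π * s))) (Ioi 0) := fun a _ b _ h ↦ by
    simpa [pi_ne_zero] using h
  rw [intervalIntegral.integral_of_le zero_le_one, integral_Ioc_eq_integral_Ioo, ← himage,
    integral_image_eq_integral_abs_deriv_smul measurableSet_Ioi hderiv hinj,
    ← integral_const_mul]
  refine setIntegral_congr_fun measurableSet_Ioi fun s _ ↦ ?_
  simp only [smul_eq_mul, log_exp, abs_mul, abs_neg, abs_exp, abs_of_pos pi_pos]
  rw [exp_neg]
  field_simp

theorem bdh_integral_eleven :
    (∫ x in (0:ℝ)..1, 1 / ((π ^ 2 + Real.log x ^ 2) ^ 2 * (1 + x))) =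
      1 / (8 * π ^ 2) - 3 / (4 * π ^ 4) +
        (1 / (8 * π ^ 4)) *
          ∑' k : ℕ,
            Real.log (2 * ((k : ℝ) + 1) + 1) /
              (((k : ℝ) + 1) ^ 2 * (((k : ℝ) + 1) + 1) ^ 2) := by
  set S := ∑' k : ℕ, log (2 * ((k : ℝ) + 1) + 1) /
    (((k : ℝ) + 1) ^ 2 * (((k : ℝ) + 1) + 1) ^ 2)
  set F : ℕ → ℝ → ℝ := fun n s ↦ s / ((1 + s ^ 2) ^ 2 * (s ^ 2 + (2 * (n : ℝ) + 1) ^ 2)) with hF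
  have hF0 : IntegrableOn (F 0) (Ioi 0) ∧ ∫ s in Ioi (0 : ℝ), F 0 s = 1 / 4 := by
    simpa [hF] using integral_div_one_add_sq_cube
  have hFsucc (k : ℕ) : IntegrableOn (F (k + 1)) (Ioi 0) ∧ ∫ s in Ioi (0 : ℝ), F (k + 1) s =
      1 / 8 * (1 / (((k : ℝ) + 1) * ((k : ℝ) + 1 + 1))) -
        1 / 16 * (log (2 * ((k : ℝ) + 1) + 1) /
          (((k : ℝ) + 1) ^ 2 * (((k : ℝ) + 1) + 1) ^ 2)) := by
    have h := integral_div_one_add_sq_sq_mul (c := (2 * ((k : ℝ) + 1) + 1) ^ 2)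
      (by nlinarith [k.cast_nonneg (α := ℝ)])
    simp only [hF]
    push_cast
    refine ⟨h.1, h.2.trans ?_⟩
    rw [log_pow, show (2 * ((k : ℝ) + 1) + 1) ^ 2 - 1 = 4 * ((k + 1) * (k + 1 + 1)) by ring]
    push_cast
    field_simp
    ring
  have hint (n : ℕ) : IntegrableOn (F n) (Ioi 0) := by
    cases n with
    | zero => exact hF0.1
    | succ k => exact (hFsucc k).1
  have hsum : HasSum (fun n ↦ ∫ s in Ioi (0 : ℝ), F n s) (1 / 4 + (1 / 8 - 1 / 16 * S)) := by
    rw [← hasSum_nat_add_iff' 1]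
    simp only [Finset.sum_range_one, hF0.2, (hFsucc _).2, add_sub_cancel_left]
    simpa only [mul_one] using (hasSum_one_div_succ_mul_succ_succ.mul_left (1 / 8)).sub
      (summable_log_odd_div.hasSum.mul_left (1 / 16))
  have hnorm : Summable fun n ↦ ∫ s in Ioi (0 : ℝ), ‖F n s‖ := by
    refine hsum.summable.congr fun n ↦ setIntegral_congr_fun measurableSet_Ioi fun s hs ↦ ?_
    have : 0 < s := hs
    exact (norm_of_nonneg (by positivity)).symm
  have htsum : ∫ s in Ioi (0 : ℝ), ∑' n, F n s = 1 / 4 + (1 / 8 - 1 / 16 * S) :=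
    (hasSum_integral_of_summable_integral_norm hint hnorm).unique hsum
  have hpoint : ∀ s ∈ Ioi (0 : ℝ), ∑' n, F n s =
      π / 4 * (1 / (1 + s ^ 2) ^ 2) - π / 2 * (1 / (1 + s ^ 2) ^ 2 * (1 / (exp (π * s) + 1))) :=
    fun s hs ↦ by
      rw [show π / 4 * (1 / (1 + s ^ 2) ^ 2) -
        π / 2 * (1 / (1 + s ^ 2) ^ 2 * (1 / (exp (π * s) + 1))) =
        1 / (1 + s ^ 2) ^ 2 * (π / 4 - π / 2 * (1 / (exp (π * s) + 1))) by ring]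
      refine HasSum.tsum_eq ?_
      convert! (hasSum_div_sq_add_odd_sq hs).mul_left (1 / (1 + s ^ 2) ^ 2) using 2 with n
      rw [div_mul_div_comm, one_mul]
  have hfermi : IntegrableOn (fun s : ℝ ↦ 1 / (1 + s ^ 2) ^ 2 * (1 / (exp (π * s) + 1)))
      (Ioi 0) := by
    refine integral_one_div_one_add_sq_sq.1.mono' (by fun_prop) (ae_of_all _ fun s ↦ ?_)
    rw [norm_of_nonneg (by positivity)]
    refine mul_le_of_le_one_right (by positivity) ?_
    rw [div_le_one (by positivity)]
    linarith [exp_pos (π * s)]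
  rw [setIntegral_congr_fun measurableSet_Ioi hpoint,
    integral_sub (integral_one_div_one_add_sq_sq.1.const_mul _) (hfermi.const_mul _),
    integral_const_mul, integral_const_mul, integral_one_div_one_add_sq_sq.2] at htsum
  rw [integral_eq_integral_Ioi_fermi]
  have hval : ∫ s in Ioi (0 : ℝ), 1 / (1 + s ^ 2) ^ 2 * (1 / (exp (π * s) + 1)) =
      2 / π * (π / 4 * (π / 4) - (1 / 4 + (1 / 8 - 1 / 16 * S))) := by
    rw [← htsum, sub_sub_cancel, ← mul_assoc, div_mul_div_cancel₀ pi_ne_zero,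
      div_self two_ne_zero, one_mul]
  rw [hval]
  field_simp
  ring
end
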